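/- Let 0 < ε ≤ 1/√m. Then Pr[Binomial(m, 1/2 + ε) > m/2] ≥ 1/2 + c₁·√m·ε − c₂/√m for absolute constants c₁, c₂ > 0. -/

import Mathlib

/-- `Pr[Binomial(m, p) > m/2]`, written out as the explicit sum of binomial
probabilities over outcomes exceeding `m/2`. -/
noncomputable def binomialTailGtHalf (m : ℕ) (p : ℝ) : ℝ :=
  ∑ i ∈ Finset.range (m + 1),
    if (m : ℝ) / 2 < (i : ℝ) then (m.choose i : ℝ) * p ^ i * (1 - p) ^ (m - i) else 0

lemma tail_eq (m : ℕ) (p : ℝ) : binomialTailGtHalf m p =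
    (∑ j ∈ Finset.range (m - m / 2), bernsteinPolynomial ℝ m (m / 2 + j + 1)).eval p := by
  unfold binomialTailGtHalf
  rw [← Finset.sum_filter]
  have h : (Finset.range (m + 1)).filter (fun i : ℕ => (m : ℝ) / 2 < (i : ℝ))
      = Finset.Ico (m / 2 + 1) (m + 1) := by
    ext i
    simp only [Finset.mem_filter, Finset.mem_range, Finset.mem_Ico]
    have : (m : ℝ) / 2 < (i : ℝ) ↔ m < 2 * i := by
      rw [div_lt_iff₀ (by norm_num)]
      constructor
      · intro h; have : (m : ℝ) < ((2 * i : ℕ) : ℝ) := by push_cast; linarith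
        exact_mod_cast this
      · intro h; have : (m : ℝ) < ((2 * i : ℕ) : ℝ) := by exact_mod_cast h
        push_cast at this; linarith
    rw [this]; omega
  rw [h, Finset.sum_Ico_eq_sum_range, Polynomial.eval_finsetSum,
    show m + 1 - (m / 2 + 1) = m - m / 2 by omega]
  refine Finset.sum_congr rfl fun j _ => ?_
  rw [show m / 2 + 1 + j = m / 2 + j + 1 by omega]
  simp [bernsteinPolynomial]

lemma tail_deriv (m : ℕ) (p : ℝ) : HasDerivAt (binomialTailGtHalf m)
    (m * ((m - 1).choose (m / 2) * p ^ (m / 2) * (1 - p) ^ (m - 1 - m / 2))) p := by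
  have h1 : binomialTailGtHalf m = fun p =>
    (∑ j ∈ Finset.range (m - m / 2), bernsteinPolynomial ℝ m (m / 2 + j + 1)).eval p :=
    funext (tail_eq m)
  rw [h1]
  refine (Polynomial.hasDerivAt _ p).congr_deriv ?_
  rw [Polynomial.derivative_sum]
  simp only [bernsteinPolynomial.derivative_succ]
  rw [← Finset.mul_sum]
  have := Finset.sum_range_sub' (fun j => bernsteinPolynomial ℝ (m - 1) (m / 2 + j)) (m - m / 2)
  simp only [← add_assoc] at this
  rw [this]
  have h0 : bernsteinPolynomial ℝ (m - 1) (m / 2 + (m - m / 2)) = 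
      if m = 0 then 1 else 0 := by
    split_ifs with h
    · subst h; simp [bernsteinPolynomial]
    · exact bernsteinPolynomial.eq_zero_of_lt _ (by omega)
  rw [h0]
  split_ifs with h
  · subst h; simp
  · simp [bernsteinPolynomial]

lemma cb_lower (k : ℕ) (hk : 1 ≤ k) : (16 : ℝ) ^ k ≤ 4 * k * (k.centralBinom : ℝ) ^ 2 := by
  induction k, hk using Nat.le_induction with
  | base => norm_num [Nat.centralBinom, Nat.choose]
  | succ n hn ih =>
    have h : ((n : ℝ) + 1) * (n + 1).centralBinom = 2 * (2 * n + 1) * n.centralBinom := by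
      exact_mod_cast Nat.succ_mul_centralBinom_succ n
    have hp : (0 : ℝ) < n + 1 := by positivity
    have h2 : ((n : ℝ) + 1) * 16 ^ (n + 1) ≤
        (n + 1) * (4 * (n + 1) * ((n + 1).centralBinom : ℝ) ^ 2) := by
      have e : ((n : ℝ) + 1) * (4 * (n + 1) * ((n + 1).centralBinom : ℝ) ^ 2)
        = 4 * (2 * (2 * n + 1) * n.centralBinom) ^ 2 := by rw [← h]; ring
      rw [e, pow_succ]
      nlinarith [mul_le_mul_of_nonneg_left ih hp.le, sq_nonneg (n.centralBinom : ℝ)]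
    push_cast
    exact le_of_mul_le_mul_left h2 hp

lemma cb_upper (k : ℕ) : (2 * k + 1) * (k.centralBinom : ℝ) ^ 2 ≤ (16 : ℝ) ^ k := by
  induction k with
  | zero => norm_num [Nat.centralBinom]
  | succ n ih =>
    have h : ((n : ℝ) + 1) * (n + 1).centralBinom = 2 * (2 * n + 1) * n.centralBinom := by
      exact_mod_cast Nat.succ_mul_centralBinom_succ n
    have hp : (0 : ℝ) < (n + 1) ^ 2 := by positivity
    have h2 : ((n : ℝ) + 1) ^ 2 * ((2 * (n + 1) + 1) * ((n + 1).centralBinom : ℝ) ^ 2) ≤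
        (n + 1) ^ 2 * 16 ^ (n + 1) := by
      have e : ((n : ℝ) + 1) ^ 2 * ((2 * (n + 1) + 1) * ((n + 1).centralBinom : ℝ) ^ 2)
        = (2 * n + 3) * (2 * (2 * n + 1) * n.centralBinom) ^ 2 := by rw [← h]; ring
      have e2 : (2 * n + 3) * (2 * (2 * n + 1) * (n.centralBinom : ℝ)) ^ 2
        = (4 * (2 * n + 1) * (2 * n + 3)) * ((2 * n + 1) * (n.centralBinom : ℝ) ^ 2) := by ring
      have hn : (0 : ℝ) ≤ n := by positivity
      have e3 : (4 * (2 * n + 1) * (2 * n + 3)) * ((2 * n + 1) * (n.centralBinom : ℝ) ^ 2)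
        ≤ (16 * (n + 1) ^ 2) * 16 ^ n := by
        apply mul_le_mul _ ih (by positivity) (by positivity)
        nlinarith
      rw [e, e2, pow_succ 16 n]
      linarith
    push_cast
    exact le_of_mul_le_mul_left h2 hp

lemma le_of_sq_le_sq_aux {a b : ℝ} (h : a ^ 2 ≤ b ^ 2) (hb : 0 ≤ b) : a ≤ b :=
  (le_abs_self a).trans (abs_le_of_sq_le_sq h hb)

lemma tail_half (m : ℕ) (hm : 1 ≤ m) :
    1 / 2 - 1 / Real.sqrt m ≤ binomialTailGtHalf m (1 / 2) := by
  set f : ℕ → ℝ := fun i => (m.choose i : ℝ) * (1 / 2) ^ m with hf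
  have hA : binomialTailGtHalf m (1 / 2) =
      ∑ i ∈ Finset.range (m + 1), if m < 2 * i then f i else 0 := by
    unfold binomialTailGtHalf
    refine Finset.sum_congr rfl fun i hi => ?_
    have hi' : i ≤ m := by simpa [Nat.lt_succ_iff] using hi
    have : (m : ℝ) / 2 < (i : ℝ) ↔ m < 2 * i := by
      rw [div_lt_iff₀ (by norm_num), mul_comm]
      exact_mod_cast Iff.rfl
    simp only [this, hf]
    split_ifs
    · rw [show (1 : ℝ) - 1 / 2 = 1 / 2 by norm_num, mul_assoc, ← pow_add,
        Nat.add_sub_cancel' hi']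
    · rfl
  have hB : (∑ i ∈ Finset.range (m + 1), if m < 2 * i then f i else 0) =
      ∑ i ∈ Finset.range (m + 1), if 2 * i < m then f i else 0 := by
    rw [← Finset.sum_range_reflect]
    refine Finset.sum_congr rfl fun i hi => ?_
    have hi' : i ≤ m := by simpa [Nat.lt_succ_iff] using hi
    rw [show m + 1 - 1 - i = m - i by omega]
    have : m < 2 * (m - i) ↔ 2 * i < m := by omega
    simp only [this, hf, Nat.choose_symm hi']
  have hS : ∑ i ∈ Finset.range (m + 1), f i = 1 := by
    rw [hf, ← Finset.sum_mul]
    have : (∑ i ∈ Finset.range (m + 1), (m.choose i : ℝ)) = 2 ^ m := by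
      exact_mod_cast Nat.sum_range_choose m
    rw [this, ← mul_pow]; norm_num
  have hsplit : ∑ i ∈ Finset.range (m + 1), f i =
      (∑ i ∈ Finset.range (m + 1), if m < 2 * i then f i else 0) +
      (∑ i ∈ Finset.range (m + 1), if 2 * i < m then f i else 0) +
      (∑ i ∈ Finset.range (m + 1), if 2 * i = m then f i else 0) := by
    rw [← Finset.sum_add_distrib, ← Finset.sum_add_distrib]
    refine Finset.sum_congr rfl fun i hi => ?_
    rcases lt_trichotomy m (2 * i) with h | h | h
    · simp [h, h.not_gt, h.ne']
    · simp [h]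
    · simp [h, h.not_gt, h.ne]
  have hmpos : (0 : ℝ) < m := by exact_mod_cast hm
  have hM : (∑ i ∈ Finset.range (m + 1), if 2 * i = m then f i else 0) ≤ 1 / Real.sqrt m := by
    rcases Nat.even_or_odd' m with ⟨k, hk | hk⟩
    · have : (∑ i ∈ Finset.range (m + 1), if 2 * i = m then f i else 0) = f k := by
        rw [Finset.sum_eq_single k]
        · simp [hk]
        · intro b _ hb; rw [if_neg]; omega
        · intro h; exfalso; apply h; simp; omega
      rw [this]
      have hfk : f k = (k.centralBinom : ℝ) / 4 ^ k := by
        simp only [hf, hk, Nat.centralBinom, pow_mul]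
        rw [div_eq_mul_inv _ ((4 : ℝ) ^ k), ← inv_pow]; norm_num
      rw [hfk, le_div_iff₀ (Real.sqrt_pos.2 hmpos)]
      refine le_of_sq_le_sq_aux ?_ zero_le_one
      rw [mul_pow, Real.sq_sqrt hmpos.le, div_pow, ← pow_mul, mul_comm k 2, pow_mul]
      have h16 : (0 : ℝ) < 16 ^ k := by positivity
      norm_num
      rw [div_mul_eq_mul_div, div_le_one h16, hk]
      push_cast
      nlinarith [cb_upper k, sq_nonneg (k.centralBinom : ℝ)]
    · have : (∑ i ∈ Finset.range (m + 1), if 2 * i = m then f i else 0) = 0 := by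
        apply Finset.sum_eq_zero
        intro i _; rw [if_neg]; omega
      rw [this]; positivity
  have hpos : 0 ≤ 1 / Real.sqrt m := by positivity
  rw [hA]
  rw [← hB] at hsplit
  linarith

lemma deriv_lower (m : ℕ) (hm : 8 ≤ m) (d : ℝ) (hd : 0 ≤ d) (hd2 : d ≤ 1 / Real.sqrt m) :
    Real.exp (-4) / 4 * Real.sqrt m ≤
    m * ((m - 1).choose (m / 2) * (1 / 2 + d) ^ (m / 2) *
      (1 - (1 / 2 + d)) ^ (m - 1 - m / 2)) := by
  have hmpos : (0 : ℝ) < m := by exact_mod_cast (by omega : 0 < m)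
  have hs := Real.sqrt_pos.2 hmpos
  have hdm : d ^ 2 * m ≤ 1 := by
    rw [le_div_iff₀ hs] at hd2
    have : (d * Real.sqrt m) ^ 2 ≤ 1 := pow_le_one₀ (by positivity) hd2
    rwa [mul_pow, Real.sq_sqrt hmpos.le] at this
  have hm8 : (8 : ℝ) ≤ m := by exact_mod_cast hm
  have hd3 : d ≤ 1 / 2 := by nlinarith
  obtain ⟨k, hk⟩ : ∃ k, m / 2 = k := ⟨_, rfl⟩
  have hk4 : 4 ≤ k := by omega
  have hk4' : (4 : ℝ) ≤ k := by exact_mod_cast hk4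
  have hkm : 2 * (k : ℝ) ≤ m := by exact_mod_cast (by omega : 2 * k ≤ m)
  have hmk : (m : ℝ) ≤ 4 * k := by exact_mod_cast (by omega : m ≤ 4 * k)
  set P := (1 / 2 + d) with hP
  have hq0 : 0 ≤ 1 - P := by linarith
  have hq1 : 1 - P ≤ 1 := by linarith
  have hP0 : 0 ≤ P := by linarith
  -- step 1
  have h1 : k * (k.centralBinom : ℝ) * (P * (1 - P)) ^ k ≤
      m * ((m - 1).choose k * P ^ k * (1 - P) ^ (m - 1 - k)) := by
    rcases Nat.even_or_odd' m with ⟨l, hl | hl⟩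
    · have hlk : l = k := by omega
      subst hlk
      obtain ⟨n, rfl⟩ : ∃ n, l = n + 1 := ⟨l - 1, by omega⟩
      have e1 : m - 1 = 2 * n + 1 := by omega
      have e2 : m - 1 - (n + 1) = n := by omega
      have e3 : (m : ℝ) = 2 * (n + 1) := by rw [hl]; push_cast; ring
      have e4 : ((n + 1).centralBinom : ℝ) = 2 * ((2 * n + 1).choose (n + 1) : ℝ) := by
        have h := Nat.choose_succ_succ (2 * n + 1) n
        have h' : (2 * n + 1).choose n = (2 * n + 1).choose (n + 1) :=
          Nat.choose_symm_half n |>.symm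
        have : (n + 1).centralBinom = 2 * (2 * n + 1).choose (n + 1) := by
          rw [Nat.centralBinom, show 2 * (n + 1) = (2 * n + 1) + 1 by ring, h]
          simp only [Nat.succ_eq_add_one]; omega
        exact_mod_cast this
      rw [e2, e1, e3, e4, mul_pow]
      have : (1 - P) ^ (n + 1) ≤ (1 - P) ^ n := pow_le_pow_of_le_one hq0 hq1 (by omega)
      have := mul_le_mul_of_nonneg_left this (show 0 ≤ 2 * ((n : ℝ) + 1) *
        ((2 * n + 1).choose (n + 1)) * P ^ (n + 1) by positivity)
      push_cast
      linarith
    · have hlk : l = k := by omega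
      subst hlk
      have e1 : m - 1 = 2 * l := by omega
      have e2 : m - 1 - l = l := by omega
      rw [e2, e1, mul_pow, Nat.centralBinom]
      have : 0 ≤ ((2 * l).choose l : ℝ) * P ^ l * (1 - P) ^ l := by positivity
      nlinarith
  rw [hk]
  refine le_trans ?_ h1
  have hkpos : (0 : ℝ) < k := by linarith
  have h2 : Real.sqrt m / 4 ≤ k * (k.centralBinom : ℝ) / 4 ^ k := by
    rw [le_div_iff₀ (by positivity)]
    refine le_of_sq_le_sq_aux ?_ (by positivity)
    have : ((4 : ℝ) ^ k) ^ 2 = 16 ^ k := by rw [← pow_mul, mul_comm k 2, pow_mul]; norm_num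
    rw [mul_pow, this, div_pow, Real.sq_sqrt hmpos.le]
    have hl := cb_lower k (by omega)
    have h16 : (0 : ℝ) < 16 ^ k := by positivity
    calc (m : ℝ) / 4 ^ 2 * 16 ^ k ≤ (4 * k / 4 ^ 2) * (4 * k * (k.centralBinom : ℝ) ^ 2) := by
          gcongr
      _ = _ := by ring
  have h3 : Real.exp (-4) ≤ (4 * (P * (1 - P))) ^ k := by
    have e : 4 * (P * (1 - P)) = 1 - 4 * d ^ 2 := by rw [hP]; ring
    rw [e]
    have a1 : (1 + 4 / (k : ℝ))⁻¹ ≤ 1 - 4 * d ^ 2 := by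
      have : d ^ 2 ≤ 1 / (2 * k) := by
        rw [le_div_iff₀ (by positivity)]; nlinarith [sq_nonneg d]
      have h4 : 1 - 2 / (k : ℝ) ≤ 1 - 4 * d ^ 2 := by
        have : 4 * (1 / (2 * (k : ℝ))) = 2 / k := by field_simp; norm_num
        linarith
      refine le_trans ?_ h4
      rw [inv_le_iff_one_le_mul₀ (by positivity)]
      have : (1 - 2 / (k : ℝ)) * (1 + 4 / k) = 1 + 2 * (k - 4) / k ^ 2 := by field_simp; ring
      rw [this]
      have : 0 ≤ 2 * ((k : ℝ) - 4) / k ^ 2 := div_nonneg (by linarith) (by positivity)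
      linarith
    have a2 : (1 + 4 / (k : ℝ)) ^ k ≤ Real.exp 4 := by
      have := Real.add_one_le_exp (4 / (k : ℝ))
      calc (1 + 4 / (k : ℝ)) ^ k ≤ (Real.exp (4 / k)) ^ k := by
            apply pow_le_pow_left₀ (by positivity); linarith
        _ = Real.exp 4 := by rw [← Real.exp_nat_mul]; congr 1; field_simp
    calc Real.exp (-4) = (Real.exp 4)⁻¹ := Real.exp_neg 4
      _ ≤ ((1 + 4 / (k : ℝ)) ^ k)⁻¹ := by gcongr
      _ = ((1 + 4 / (k : ℝ))⁻¹) ^ k := (inv_pow _ _).symm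
      _ ≤ _ := pow_le_pow_left₀ (by positivity) a1 k
  calc Real.exp (-4) / 4 * Real.sqrt m = Real.sqrt m / 4 * Real.exp (-4) := by ring
    _ ≤ (k * (k.centralBinom : ℝ) / 4 ^ k) * (4 * (P * (1 - P))) ^ k := by gcongr
    _ = _ := by rw [mul_pow 4]; field_simp

lemma tail_nonneg (m : ℕ) (hm : 1 ≤ m) (ε : ℝ) (h0 : 0 < ε) (h1 : ε ≤ 1 / Real.sqrt m) :
    0 ≤ binomialTailGtHalf m (1 / 2 + ε) := by
  have hmpos : (0 : ℝ) < m := by exact_mod_cast hm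
  have hs := Real.sqrt_pos.2 hmpos
  have hdm : ε ^ 2 * m ≤ 1 := by
    rw [le_div_iff₀ hs] at h1
    have : (ε * Real.sqrt m) ^ 2 ≤ 1 := pow_le_one₀ (by positivity) h1
    rwa [mul_pow, Real.sq_sqrt hmpos.le] at this
  by_cases h4 : 4 ≤ m
  · have h4' : (4 : ℝ) ≤ m := by exact_mod_cast h4
    have : ε ≤ 1 / 2 := by nlinarith
    have hq : 0 ≤ 1 - (1 / 2 + ε) := by linarith
    unfold binomialTailGtHalf
    apply Finset.sum_nonneg
    intro i _
    split_ifs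
    · positivity
    · exact le_rfl
  · rw [tail_eq]
    have : m = 1 ∨ m = 2 ∨ m = 3 := by omega
    rcases this with rfl | rfl | rfl
    · simp [bernsteinPolynomial]; positivity
    · simp [bernsteinPolynomial]; positivity
    · norm_num at hdm
      have : ε ≤ 1 := by nlinarith
      norm_num [bernsteinPolynomial, Finset.sum_range_succ, Nat.choose]
      nlinarith [mul_nonneg (sq_nonneg (1 / 2 + ε)) (sub_nonneg.2 this)]

/-- Anti-concentration for the binomial distribution: for `0 < ε ≤ 1/√m`,
`Pr[Binomial(m, 1/2 + ε) > m/2] ≥ 1/2 + c₁·√m·ε − c₂/√m` for absolute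
constants `c₁, c₂ > 0`. -/
theorem binomial_anti_concentration :
    ∃ c₁ c₂ : ℝ, 0 < c₁ ∧ 0 < c₂ ∧ ∀ (m : ℕ), 1 ≤ m → ∀ ε : ℝ, 0 < ε →
      ε ≤ 1 / Real.sqrt m →
      1 / 2 + c₁ * Real.sqrt m * ε - c₂ / Real.sqrt m ≤
        binomialTailGtHalf m (1 / 2 + ε) := by
  refine ⟨Real.exp (-4) / 4, 10, by positivity, by norm_num, ?_⟩
  intro m hm ε h0 h1
  have hmpos : (0 : ℝ) < m := by exact_mod_cast hm
  have hs := Real.sqrt_pos.2 hmpos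
  by_cases h8 : 8 ≤ m
  · have hder := (convex_Icc (1 / 2 : ℝ) (1 / 2 + ε)).mul_sub_le_image_sub_of_le_deriv
      (f := binomialTailGtHalf m) (C := Real.exp (-4) / 4 * Real.sqrt m)
      (fun x _ => (tail_deriv m x).continuousAt.continuousWithinAt)
      (fun x _ => (tail_deriv m x).differentiableAt.differentiableWithinAt)
      (by
        intro x hx
        rw [interior_Icc] at hx
        rw [(tail_deriv m x).deriv]
        have := deriv_lower m h8 (x - 1 / 2) (by linarith [hx.1]) (by linarith [hx.2])
        rwa [show 1 / 2 + (x - 1 / 2) = x by ring] at this)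
      (1 / 2) (by constructor <;> linarith) (1 / 2 + ε) (by constructor <;> linarith)
      (by linarith)
    have := tail_half m hm
    have h10 : 1 / Real.sqrt m ≤ 10 / Real.sqrt m := by gcongr; norm_num
    rw [add_sub_cancel_left] at hder
    linarith
  · refine le_trans ?_ (tail_nonneg m hm ε h0 h1)
    have he : Real.exp (-4) ≤ 1 := Real.exp_le_one_iff.2 (by norm_num)
    have hse : Real.sqrt m * ε ≤ 1 := by rw [le_div_iff₀ hs] at h1; linarith
    have hm8 : (m : ℝ) ≤ 8 := by exact_mod_cast (by omega : m ≤ 8)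
    have hs3 : Real.sqrt m ≤ 3 := Real.sqrt_le_iff.2 ⟨by norm_num, by linarith⟩
    have : 3 ≤ 10 / Real.sqrt m := by rw [le_div_iff₀ hs]; linarith
    have h2 : Real.exp (-4) * (Real.sqrt m * ε) ≤ 1 :=
      mul_le_one₀ he (by positivity) hse
    linarith
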